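/- The map f' is injective on the set of reflections of W(B_n), and the map F : NC(B_n) → {subspaces of 𝔽₃^n} satisfies: (i) v ≤ w in absolute order implies F(v) ⊆ F(w); (ii) dim F(w) = ℓ_T(w) for every w ∈ NC(B_n); (iii) F is injective on NC(B_n). In particular F is a rank-preserving embedding of the noncrossing partition lattice of type B_n into the lattice of linear subspaces of 𝔽₃^n. -/

import Mathlib

namespace NCPaper

variable {G : Type*} [Group G]

/-- `lenT T w` is the least `k` such that `w` is a product of `k` elements of `T`
(the reflection length with respect to `T`). -/
noncomputable def lenT (T : Set G) (w : G) : ℕ :=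
  sInf {k | ∃ l : List G, (∀ t ∈ l, t ∈ T) ∧ l.length = k ∧ l.prod = w}

/-- The absolute order with respect to the generating set `T`. -/
def absLe (T : Set G) (v w : G) : Prop :=
  lenT T w = lenT T v + lenT T (v⁻¹ * w)

/-- Strict absolute order. -/
def absLt (T : Set G) (v w : G) : Prop := absLe T v w ∧ v ≠ w

/-- The noncrossing partition lattice `NC(W, c)`: the interval `[1, c]` in absolute order. -/
def NC (T : Set G) (c : G) : Set G := {w | absLe T w c}

/-- The signed permutation group `W(B_n)` acts on `{1, …, n} × {±}`;
we model the ground set as `Fin n × Bool`. -/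
abbrev BGround (n : ℕ) := Fin n × Bool

/-- The reflection `[i]`, i.e. the transposition `(i, -i)`. -/
def refl0 {n : ℕ} (i : Fin n) : Equiv.Perm (BGround n) :=
  Equiv.swap (i, false) (i, true)

/-- The reflection `⦅i, j⦆ = (i, j)(-i, -j)`. -/
def reflP {n : ℕ} (i j : Fin n) : Equiv.Perm (BGround n) :=
  Equiv.swap (i, false) (j, false) * Equiv.swap (i, true) (j, true)

/-- The reflection `⦅i, -j⦆ = (i, -j)(-i, j)`. -/
def reflM {n : ℕ} (i j : Fin n) : Equiv.Perm (BGround n) :=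
  Equiv.swap (i, false) (j, true) * Equiv.swap (i, true) (j, false)

/-- The set of reflections of `W(B_n)`. -/
def TB (n : ℕ) : Set (Equiv.Perm (BGround n)) :=
  {t | (∃ i, t = refl0 i) ∨ (∃ i j, i ≠ j ∧ t = reflP i j) ∨
       (∃ i j, i ≠ j ∧ t = reflM i j)}

/-- The Coxeter element `c = [1, 2, …, n]` of `W(B_n)`: it sends `i ↦ i+1` and
`-i ↦ -(i+1)` for `i < n`, and `n ↦ -1`, `-n ↦ 1`. -/
def cB (n : ℕ) : Equiv.Perm (BGround n) where
  toFun p := if h : p.1.val + 1 < n then (⟨p.1.val + 1, h⟩, p.2)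
             else ((⟨0, by have := p.1.isLt; omega⟩ : Fin n), !p.2)
  invFun p := if h : p.1.val = 0 then ((⟨n - 1, by have := p.1.isLt; omega⟩ : Fin n), !p.2)
              else ((⟨p.1.val - 1, by have := p.1.isLt; omega⟩ : Fin n), p.2)
  left_inv := by
    rintro ⟨i, s⟩
    dsimp only
    by_cases h : i.val + 1 < n
    · rw [dif_pos h, dif_neg (by simp : ¬ ((⟨i.val + 1, h⟩ : Fin n).val = 0))]
      exact Prod.ext (Fin.ext (by simp)) rfl
    · rw [dif_neg h, dif_pos rfl]
      exact Prod.ext (Fin.ext (by simp only [Fin.val_mk]; have := i.isLt; omega))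
        (Bool.not_not s)
  right_inv := by
    rintro ⟨i, s⟩
    dsimp only
    by_cases h : i.val = 0
    · rw [dif_pos h,
        dif_neg (by simp only [Fin.val_mk]; have := i.isLt; omega :
          ¬ ((⟨n - 1, _⟩ : Fin n).val + 1 < n))]
      exact Prod.ext (Fin.ext (by simp only [Fin.val_mk]; omega)) (Bool.not_not s)
    · rw [dif_neg h,
        dif_pos (by simp only [Fin.val_mk]; have := i.isLt; omega :
          (⟨i.val - 1, _⟩ : Fin n).val + 1 < n)]
      exact Prod.ext (Fin.ext (by simp only [Fin.val_mk]; omega)) rfl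

end NCPaper
namespace NCPaper

/-- The standard basis vector `e_i` of `𝔽₃^n`. -/
def eB (n : ℕ) (i : Fin n) : Fin n → ZMod 3 := Pi.single i 1

/-- `lineOfB n t L` says that `t` is a reflection of `W(B_n)` and `L` is the line
`f'(t)` of `𝔽₃^n`: `f'([i]) = span {e_i}`, `f'(⦅i,j⦆) = span {e_i - e_j}`, and
`f'(⦅i,-j⦆) = span {e_i + e_j}`. -/
def lineOfB (n : ℕ) (t : Equiv.Perm (BGround n))
    (L : Submodule (ZMod 3) (Fin n → ZMod 3)) : Prop :=
  (∃ i, t = refl0 i ∧ L = Submodule.span (ZMod 3) {eB n i}) ∨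
  (∃ i j, i ≠ j ∧ t = reflP i j ∧ L = Submodule.span (ZMod 3) {eB n i - eB n j}) ∨
  (∃ i j, i ≠ j ∧ t = reflM i j ∧ L = Submodule.span (ZMod 3) {eB n i + eB n j})

/-- `FB n w` is the subspace of `𝔽₃^n` spanned by the union of the lines `f'(t)` over
all reflections `t ≤ w` in absolute order. -/
def FB (n : ℕ) (w : Equiv.Perm (BGround n)) : Submodule (ZMod 3) (Fin n → ZMod 3) :=
  sSup {L | ∃ t, lineOfB n t L ∧ absLe (TB n) t w}

/-- The group `W(B_n)` of signed permutations. -/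
def signedPerm (n : ℕ) : Subgroup (Equiv.Perm (BGround n)) where
  carrier := {w | ∀ p, w (p.1, !p.2) = ((w p).1, !(w p).2)}
  mul_mem' := by
    intro a b ha hb p
    simp only [Equiv.Perm.mul_apply, hb p, ha (b p)]
  one_mem' := fun _ => rfl
  inv_mem' := by
    intro a ha p
    have h := ha (a⁻¹ p)
    rw [show a (a⁻¹ p) = p from a.apply_symm_apply p] at h
    rw [← h]
    exact a.symm_apply_apply _

/-- The odd extension of a vector to the ground set `{±1, …, ±n}`. -/
def oddExt {n : ℕ} (x : Fin n → ZMod 3) (p : BGround n) : ZMod 3 :=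
  if p.2 then -x p.1 else x p.1

theorem oddExt_not {n : ℕ} (x : Fin n → ZMod 3) (p : BGround n) :
    oddExt x (p.1, !p.2) = -oddExt x p := by
  rcases p with ⟨i, _ | _⟩ <;> simp [oddExt]

/-- The action of a signed permutation on `𝔽₃^n`. -/
def signedAct {n : ℕ} (w : Equiv.Perm (BGround n)) :
    (Fin n → ZMod 3) →ₗ[ZMod 3] (Fin n → ZMod 3) where
  toFun x i := oddExt x (w⁻¹ (i, false))
  map_add' x y := by
    funext i
    simp only [oddExt, Pi.add_apply]
    split_ifs <;> ring
  map_smul' a x := by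
    funext i
    simp only [oddExt, Pi.smul_apply, smul_eq_mul, RingHom.id_apply]
    split_ifs <;> ring

theorem signedAct_apply {n : ℕ} (w : Equiv.Perm (BGround n)) (x : Fin n → ZMod 3) (i : Fin n) :
    signedAct w x i = oddExt x (w⁻¹ (i, false)) := rfl

theorem oddExt_signedAct {n : ℕ} {w : Equiv.Perm (BGround n)} (hw : w ∈ signedPerm n)
    (x : Fin n → ZMod 3) (p : BGround n) : oddExt (signedAct w x) p = oddExt x (w⁻¹ p) := by
  rcases p with ⟨i, _ | _⟩
  · rfl
  · have h := (signedPerm n).inv_mem hw (i, false)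
    simp only [Bool.not_false] at h
    rw [h, oddExt_not]
    rfl

theorem signedAct_one {n : ℕ} (x : Fin n → ZMod 3) :
    signedAct (1 : Equiv.Perm (BGround n)) x = x := rfl

theorem signedAct_mul {n : ℕ} (v : Equiv.Perm (BGround n)) {w : Equiv.Perm (BGround n)}
    (hw : w ∈ signedPerm n) (x : Fin n → ZMod 3) :
    signedAct (v * w) x = signedAct v (signedAct w x) := by
  funext i
  rw [signedAct_apply, signedAct_apply, oddExt_signedAct hw, mul_inv_rev]
  rfl

theorem oddExt_separates {n : ℕ} {p q : BGround n} (h : ∀ x, oddExt x p = oddExt x q) :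
    p = q := by
  have h1 := h (eB n p.1)
  rcases p with ⟨i, b⟩
  rcases q with ⟨j, b'⟩
  by_cases hij : j = i
  · subst hij
    rcases b with _ | _ <;> rcases b' with _ | _ <;> simp [oddExt, eB] at h1 ⊢ <;>
      exact absurd h1 (by decide)
  · rcases b with _ | _ <;> rcases b' with _ | _ <;> simp [oddExt, eB, hij] at h1

theorem signedAct_injective {n : ℕ} {v w : Equiv.Perm (BGround n)} (hv : v ∈ signedPerm n)
    (hw : w ∈ signedPerm n) (h : ∀ x, signedAct v x = signedAct w x) : v = w := by
  apply inv_injective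
  ext1 p
  refine oddExt_separates fun x => ?_
  rw [← oddExt_signedAct hv, ← oddExt_signedAct hw, h]

theorem sum_oddExt_mul {n : ℕ} (x y : Fin n → ZMod 3) :
    ∑ p, oddExt x p * oddExt y p = -(x ⬝ᵥ y) := by
  have h3 : (3 : ZMod 3) = 0 := rfl
  rw [Fintype.sum_prod_type, dotProduct, ← Finset.sum_neg_distrib]
  refine Finset.sum_congr rfl fun i _ => ?_
  simp only [Fintype.sum_bool, oddExt]
  simp only [if_true, Bool.false_eq_true, if_false]
  linear_combination x i * y i * h3

theorem signedAct_dotProduct {n : ℕ} {w : Equiv.Perm (BGround n)} (hw : w ∈ signedPerm n)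
    (x y : Fin n → ZMod 3) : signedAct w x ⬝ᵥ signedAct w y = x ⬝ᵥ y := by
  rw [← neg_inj, ← sum_oddExt_mul, ← sum_oddExt_mul]
  simp only [oddExt_signedAct hw]
  exact Equiv.sum_comp w⁻¹ fun p => oddExt x p * oddExt y p

/-- `IsRootOf t v` says that `t` is a reflection of `W(B_n)` with root `v`. -/
def IsRootOf {n : ℕ} (t : Equiv.Perm (BGround n)) (v : Fin n → ZMod 3) : Prop :=
  (∃ i, t = refl0 i ∧ v = eB n i) ∨
  (∃ i j, i ≠ j ∧ t = reflP i j ∧ v = eB n i - eB n j) ∨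
  (∃ i j, i ≠ j ∧ t = reflM i j ∧ v = eB n i + eB n j)

theorem lineOfB_iff {n : ℕ} {t : Equiv.Perm (BGround n)}
    {L : Submodule (ZMod 3) (Fin n → ZMod 3)} :
    lineOfB n t L ↔ ∃ v, IsRootOf t v ∧ L = Submodule.span (ZMod 3) {v} := by
  constructor
  · rintro (⟨i, ht, hL⟩ | ⟨i, j, hij, ht, hL⟩ | ⟨i, j, hij, ht, hL⟩)
    · exact ⟨_, Or.inl ⟨i, ht, rfl⟩, hL⟩
    · exact ⟨_, Or.inr (Or.inl ⟨i, j, hij, ht, rfl⟩), hL⟩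
    · exact ⟨_, Or.inr (Or.inr ⟨i, j, hij, ht, rfl⟩), hL⟩
  · rintro ⟨v, ⟨i, ht, rfl⟩ | ⟨i, j, hij, ht, rfl⟩ | ⟨i, j, hij, ht, rfl⟩, hL⟩
    · exact Or.inl ⟨i, ht, hL⟩
    · exact Or.inr (Or.inl ⟨i, j, hij, ht, hL⟩)
    · exact Or.inr (Or.inr ⟨i, j, hij, ht, hL⟩)

theorem mem_TB_iff {n : ℕ} {t : Equiv.Perm (BGround n)} : t ∈ TB n ↔ ∃ v, IsRootOf t v := by
  constructor
  · rintro (⟨i, ht⟩ | ⟨i, j, hij, ht⟩ | ⟨i, j, hij, ht⟩)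
    · exact ⟨_, Or.inl ⟨i, ht, rfl⟩⟩
    · exact ⟨_, Or.inr (Or.inl ⟨i, j, hij, ht, rfl⟩)⟩
    · exact ⟨_, Or.inr (Or.inr ⟨i, j, hij, ht, rfl⟩)⟩
  · rintro ⟨v, ⟨i, ht, -⟩ | ⟨i, j, hij, ht, -⟩ | ⟨i, j, hij, ht, -⟩⟩
    · exact Or.inl ⟨i, ht⟩
    · exact Or.inr (Or.inl ⟨i, j, hij, ht⟩)
    · exact Or.inr (Or.inr ⟨i, j, hij, ht⟩)

theorem refl0_apply {n : ℕ} (i k : Fin n) (b : Bool) :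
    refl0 i (k, b) = if k = i then (i, !b) else (k, b) := by
  rcases b with _ | _ <;> by_cases h : k = i <;> simp [refl0, Equiv.swap_apply_def, h]

theorem reflP_apply {n : ℕ} (i j k : Fin n) (b : Bool) :
    reflP i j (k, b) = if k = i then (j, b) else if k = j then (i, b) else (k, b) := by
  rcases b with _ | _ <;> by_cases h : k = i <;> by_cases h' : k = j <;>
    simp [reflP, Equiv.swap_apply_def, h, h'] <;> exact Eq.symm

theorem reflM_apply {n : ℕ} {i j : Fin n} (hij : i ≠ j) (k : Fin n) (b : Bool) :
    reflM i j (k, b) = if k = i then (j, !b) else if k = j then (i, !b) else (k, b) := by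
  rcases b with _ | _ <;> by_cases h : k = i <;> by_cases h' : k = j <;>
    simp_all [reflM, Equiv.swap_apply_def, hij.symm]

theorem IsRootOf.mem_signedPerm {n : ℕ} {t : Equiv.Perm (BGround n)} {v : Fin n → ZMod 3}
    (h : IsRootOf t v) : t ∈ signedPerm n := by
  rcases h with ⟨i, rfl, -⟩ | ⟨i, j, hij, rfl, -⟩ | ⟨i, j, hij, rfl, -⟩ <;> rintro ⟨k, b⟩
  · simp only [refl0_apply]
    split_ifs <;> rfl
  · simp only [reflP_apply]
    split_ifs <;> rfl
  · simp only [reflM_apply hij]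
    split_ifs <;> rfl

theorem IsRootOf.mul_self {n : ℕ} {t : Equiv.Perm (BGround n)} {v : Fin n → ZMod 3}
    (h : IsRootOf t v) : t * t = 1 := by
  rcases h with ⟨i, rfl, -⟩ | ⟨i, j, hij, rfl, -⟩ | ⟨i, j, hij, rfl, -⟩ <;> ext1 ⟨k, b⟩
  · simp only [Equiv.Perm.mul_apply, refl0_apply]
    split_ifs <;> simp_all [refl0_apply]
  · simp only [Equiv.Perm.mul_apply, reflP_apply]
    split_ifs <;> simp_all [reflP_apply]
  · simp only [Equiv.Perm.mul_apply, reflM_apply hij]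
    split_ifs <;> simp_all

theorem IsRootOf.inv_eq {n : ℕ} {t : Equiv.Perm (BGround n)} {v : Fin n → ZMod 3}
    (h : IsRootOf t v) : t⁻¹ = t :=
  inv_eq_of_mul_eq_one_left h.mul_self

theorem IsRootOf.dotProduct_self_ne_zero {n : ℕ} {t : Equiv.Perm (BGround n)}
    {v : Fin n → ZMod 3} (h : IsRootOf t v) : v ⬝ᵥ v ≠ 0 := by
  rcases h with ⟨i, -, rfl⟩ | ⟨i, j, hij, -, rfl⟩ | ⟨i, j, hij, -, rfl⟩
  · simp [eB]
  · simp [eB, hij, hij.symm]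
    decide
  · simp [eB, hij, hij.symm]
    decide

/-- The reflection formula; over `𝔽₃` the usual factor `-2 / (v ⬝ᵥ v)` equals `v ⬝ᵥ v`. -/
theorem IsRootOf.signedAct_apply {n : ℕ} {t : Equiv.Perm (BGround n)} {v : Fin n → ZMod 3}
    (h : IsRootOf t v) (y : Fin n → ZMod 3) :
    signedAct t y = y + ((v ⬝ᵥ v) * (y ⬝ᵥ v)) • v := by
  have h3 : (3 : ZMod 3) = 0 := rfl
  funext k
  rw [NCPaper.signedAct_apply, h.inv_eq]
  rcases h with ⟨i, rfl, rfl⟩ | ⟨i, j, hij, rfl, rfl⟩ | ⟨i, j, hij, rfl, rfl⟩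
  · rw [refl0_apply]
    by_cases hk : k = i
    · subst hk
      simp [oddExt, eB]
      linear_combination -y k * h3
    · simp [oddExt, eB, hk]
  · rw [reflP_apply]
    by_cases hk : k = i
    · subst hk
      simp [oddExt, eB, hij, hij.symm]
      linear_combination (y j - y k) * h3
    · by_cases hk' : k = j
      · subst hk'
        simp [oddExt, eB, hij, hij.symm]
        linear_combination (y i - y k) * h3
      · simp [oddExt, eB, hk, hk']
  · rw [reflM_apply hij]
    by_cases hk : k = i
    · subst hk
      simp [oddExt, eB, hij, hij.symm]
      linear_combination -(y j + y k) * h3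
    · by_cases hk' : k = j
      · subst hk'
        simp [oddExt, eB, hij, hij.symm]
        linear_combination -(y i + y k) * h3
      · simp [oddExt, eB, hk, hk']

theorem zmod_three_mul_self {a : ZMod 3} (ha : a ≠ 0) : a * a = 1 := by
  revert a
  decide

theorem IsRootOf.eq_of_span_eq {n : ℕ} {t t' : Equiv.Perm (BGround n)} {v v' : Fin n → ZMod 3}
    (h : IsRootOf t v) (h' : IsRootOf t' v')
    (hs : Submodule.span (ZMod 3) {v} = Submodule.span (ZMod 3) {v'}) : t = t' := by
  refine signedAct_injective h.mem_signedPerm h'.mem_signedPerm fun y => ?_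
  obtain ⟨a, rfl⟩ : ∃ a : ZMod 3, a • v' = v := by
    rw [← Submodule.mem_span_singleton, ← hs]
    exact Submodule.mem_span_singleton_self v
  have ha : a ≠ 0 := by
    rintro rfl
    exact h.dotProduct_self_ne_zero (by simp)
  have haa := zmod_three_mul_self ha
  rw [h.signedAct_apply, h'.signedAct_apply, smul_smul]
  simp only [smul_dotProduct, dotProduct_smul, smul_eq_mul]
  congr 2
  linear_combination ((v' ⬝ᵥ v') * (y ⬝ᵥ v')) * (a * a + 1) * haa

/-- The moved space of a signed permutation. -/
def movedSpace {n : ℕ} (w : Equiv.Perm (BGround n)) : Submodule (ZMod 3) (Fin n → ZMod 3) :=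
  LinearMap.range (signedAct w - LinearMap.id)

/-- The fixed space of a signed permutation. -/
def fixedSpace {n : ℕ} (w : Equiv.Perm (BGround n)) : Submodule (ZMod 3) (Fin n → ZMod 3) :=
  LinearMap.ker (signedAct w - LinearMap.id)

theorem mem_movedSpace {n : ℕ} {w : Equiv.Perm (BGround n)} {y : Fin n → ZMod 3} :
    y ∈ movedSpace w ↔ ∃ x, signedAct w x - x = y := Iff.rfl

theorem mem_fixedSpace {n : ℕ} {w : Equiv.Perm (BGround n)} {y : Fin n → ZMod 3} :
    y ∈ fixedSpace w ↔ signedAct w y = y := by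
  rw [fixedSpace, LinearMap.mem_ker, LinearMap.sub_apply, LinearMap.id_apply, sub_eq_zero]

theorem finrank_movedSpace_add {n : ℕ} (w : Equiv.Perm (BGround n)) :
    Module.finrank (ZMod 3) (movedSpace w) + Module.finrank (ZMod 3) (fixedSpace w) = n := by
  have h := LinearMap.finrank_range_add_finrank_ker (signedAct w - LinearMap.id)
  rwa [Module.finrank_fin_fun] at h

theorem movedSpace_one {n : ℕ} : movedSpace (1 : Equiv.Perm (BGround n)) = ⊥ := by
  rw [eq_bot_iff]
  rintro y ⟨x, rfl⟩
  simp [signedAct_one]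

theorem movedSpace_mul_le {n : ℕ} (v : Equiv.Perm (BGround n)) {w : Equiv.Perm (BGround n)}
    (hw : w ∈ signedPerm n) : movedSpace (v * w) ≤ movedSpace v ⊔ movedSpace w := by
  intro y hy
  obtain ⟨x, rfl⟩ := mem_movedSpace.1 hy
  rw [signedAct_mul v hw, ← sub_add_sub_cancel _ (signedAct w x) x]
  exact Submodule.add_mem_sup ⟨_, rfl⟩ ⟨_, rfl⟩

theorem IsRootOf.movedSpace_eq {n : ℕ} {t : Equiv.Perm (BGround n)} {v : Fin n → ZMod 3}
    (h : IsRootOf t v) : movedSpace t = Submodule.span (ZMod 3) {v} := by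
  apply le_antisymm
  · intro y hy
    obtain ⟨x, rfl⟩ := mem_movedSpace.1 hy
    rw [h.signedAct_apply, add_sub_cancel_left]
    exact Submodule.smul_mem _ _ (Submodule.mem_span_singleton_self v)
  · rw [Submodule.span_singleton_le_iff_mem, mem_movedSpace]
    refine ⟨v, ?_⟩
    rw [h.signedAct_apply, add_sub_cancel_left, zmod_three_mul_self h.dotProduct_self_ne_zero,
      one_smul]

theorem IsRootOf.finrank_movedSpace {n : ℕ} {t : Equiv.Perm (BGround n)} {v : Fin n → ZMod 3}
    (h : IsRootOf t v) : Module.finrank (ZMod 3) (movedSpace t) = 1 := by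
  rw [h.movedSpace_eq]
  apply finrank_span_singleton
  rintro rfl
  exact h.dotProduct_self_ne_zero (by simp)

theorem dotProduct_eq_zero_of_mem_fixedSpace {n : ℕ} {w : Equiv.Perm (BGround n)}
    (hw : w ∈ signedPerm n) {y z : Fin n → ZMod 3} (hy : y ∈ fixedSpace w)
    (hz : z ∈ movedSpace w) : y ⬝ᵥ z = 0 := by
  obtain ⟨x, rfl⟩ := mem_movedSpace.1 hz
  have h := signedAct_dotProduct hw y x
  rw [mem_fixedSpace.1 hy] at h
  rw [dotProduct_sub, h, sub_self]

theorem IsRootOf.finrank_movedSpace_mul_lt {n : ℕ} {t w : Equiv.Perm (BGround n)}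
    {v : Fin n → ZMod 3} (h : IsRootOf t v) (hw : w ∈ signedPerm n) (hv : v ∈ movedSpace w) :
    Module.finrank (ZMod 3) (movedSpace (t * w)) < Module.finrank (ZMod 3) (movedSpace w) := by
  have h3 : (3 : ZMod 3) = 0 := rfl
  have hlt : fixedSpace w < fixedSpace (t * w) := by
    rw [SetLike.lt_iff_le_and_exists]
    constructor
    · intro y hy
      rw [mem_fixedSpace, signedAct_mul t hw, mem_fixedSpace.1 hy, h.signedAct_apply,
        dotProduct_eq_zero_of_mem_fixedSpace hw hy hv, mul_zero, zero_smul, add_zero]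
    · obtain ⟨x, hx⟩ := mem_movedSpace.1 hv
      have hvv := h.dotProduct_self_ne_zero
      refine ⟨x, ?_, fun hfix => ?_⟩
      · have hwx : signedAct w x = x + v := by rw [← hx, add_sub_cancel]
        have hnorm := signedAct_dotProduct hw x x
        rw [hwx, add_dotProduct, dotProduct_add, dotProduct_add, dotProduct_comm v x] at hnorm
        have hxv : x ⬝ᵥ v = v ⬝ᵥ v := by
          linear_combination -hnorm + (x ⬝ᵥ v) * h3
        rw [mem_fixedSpace, signedAct_mul t hw, hwx, h.signedAct_apply, add_dotProduct, hxv,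
          mul_add, zmod_three_mul_self hvv, add_assoc]
        funext k
        simp only [Pi.add_apply, Pi.smul_apply, smul_eq_mul]
        linear_combination v k * h3
      · rw [mem_fixedSpace.1 hfix, sub_self] at hx
        rw [← hx] at hvv
        exact hvv (by simp)
  have h1 := Submodule.finrank_lt_finrank_of_lt hlt
  have h2 := finrank_movedSpace_add w
  have h4 := finrank_movedSpace_add (t * w)
  omega

theorem signedAct_eB {n : ℕ} {w : Equiv.Perm (BGround n)} (hw : w ∈ signedPerm n) (i : Fin n) :
    signedAct w (eB n i) =
      if (w (i, false)).2 then -eB n (w (i, false)).1 else eB n (w (i, false)).1 := by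
  have hneg : w (i, true) = ((w (i, false)).1, !(w (i, false)).2) := hw (i, false)
  obtain ⟨⟨j, b⟩, hj⟩ : ∃ p, w (i, false) = p := ⟨_, rfl⟩
  rw [hj] at hneg ⊢
  funext k
  rw [signedAct_apply]
  obtain ⟨⟨l, b'⟩, hq⟩ : ∃ q, w⁻¹ (k, false) = q := ⟨_, rfl⟩
  have hwq : w (l, b') = (k, false) := by
    rw [← hq]
    exact w.apply_symm_apply _
  rw [hq]
  by_cases hli : l = i
  · subst hli
    rcases b' with _ | _
    · rw [hj] at hwq
      obtain ⟨rfl, rfl⟩ := Prod.mk.inj hwq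
      simp [oddExt, eB]
    · rw [hneg] at hwq
      obtain ⟨rfl, hb⟩ := Prod.mk.inj hwq
      rcases b with _ | _
      · simp at hb
      · simp [oddExt, eB]
  · have hkj : k ≠ j := by
      rintro rfl
      rcases b with _ | _
      · exact hli (Prod.mk.inj (w.injective (hwq.trans hj.symm))).1
      · exact hli (Prod.mk.inj (w.injective (hwq.trans hneg.symm))).1
    rcases b with _ | _ <;> simp [oddExt, eB, hli, hkj]

theorem exists_isRootOf_mem_movedSpace {n : ℕ} {w : Equiv.Perm (BGround n)}
    (hw : w ∈ signedPerm n) (h1 : w ≠ 1) : ∃ t v, IsRootOf t v ∧ v ∈ movedSpace w := by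
  have h3 : (3 : ZMod 3) = 0 := rfl
  obtain ⟨i, hi⟩ : ∃ i, w (i, false) ≠ (i, false) := by
    by_contra! hall
    refine h1 ?_
    ext1 ⟨i, b⟩
    rcases b with _ | _
    · exact hall i
    · have h := hw (i, false)
      rw [hall i] at h
      exact h
  have hmem : signedAct w (eB n i) - eB n i ∈ movedSpace w := ⟨_, rfl⟩
  rw [signedAct_eB hw] at hmem
  obtain ⟨⟨j, b⟩, hj⟩ : ∃ p, w (i, false) = p := ⟨_, rfl⟩
  rw [hj] at hi hmem
  by_cases hij : j = i
  · subst hij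
    rcases b with _ | _
    · exact absurd rfl hi
    · refine ⟨_, _, Or.inl ⟨j, rfl, rfl⟩, ?_⟩
      convert hmem using 1
      funext k
      simp only [if_true, Pi.sub_apply, Pi.neg_apply]
      linear_combination eB n j k * h3
  · rcases b with _ | _
    · exact ⟨_, _, Or.inr (Or.inl ⟨j, i, hij, rfl, rfl⟩), by simpa using hmem⟩
    · refine ⟨_, _, Or.inr (Or.inr ⟨j, i, hij, rfl, rfl⟩), ?_⟩
      rw [← Submodule.neg_mem_iff]
      convert hmem using 1
      rw [if_pos rfl, neg_add']

/-- Every signed permutation is a product of at most `finrank (movedSpace w)` reflections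
whose roots lie in its moved space. -/
theorem exists_reflection_factorization {n : ℕ} (w : Equiv.Perm (BGround n))
    (hw : w ∈ signedPerm n) :
    ∃ l : List (Equiv.Perm (BGround n)), (∀ t ∈ l, ∃ v, IsRootOf t v ∧ v ∈ movedSpace w) ∧
      l.length ≤ Module.finrank (ZMod 3) (movedSpace w) ∧ l.prod = w := by
  induction hk : Module.finrank (ZMod 3) (movedSpace w) using Nat.strong_induction_on
    generalizing w with
  | _ k ih =>
    by_cases h1 : w = 1
    · subst h1
      exact ⟨[], by simp, by simp, by simp⟩
    · obtain ⟨t, v, htv, hv⟩ := exists_isRootOf_mem_movedSpace hw h1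
      have hlt := htv.finrank_movedSpace_mul_lt hw hv
      rw [hk] at hlt
      obtain ⟨l, hl, hlen, hprod⟩ := ih _ hlt (t * w)
        ((signedPerm n).mul_mem htv.mem_signedPerm hw) rfl
      have hle : movedSpace (t * w) ≤ movedSpace w := by
        refine (movedSpace_mul_le t hw).trans (sup_le ?_ le_rfl)
        rwa [htv.movedSpace_eq, Submodule.span_singleton_le_iff_mem]
      refine ⟨t :: l, ?_, ?_, ?_⟩
      · intro s hs
        rcases List.mem_cons.1 hs with rfl | hs
        · exact ⟨v, htv, hv⟩
        · obtain ⟨u, hu, hu'⟩ := hl s hs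
          exact ⟨u, hu, hle hu'⟩
      · rw [List.length_cons]
        omega
      · rw [List.prod_cons, hprod, ← mul_assoc, htv.mul_self, one_mul]

theorem list_prod_mem_signedPerm {n : ℕ} {l : List (Equiv.Perm (BGround n))}
    (hl : ∀ t ∈ l, t ∈ TB n) : l.prod ∈ signedPerm n := by
  refine (signedPerm n).list_prod_mem fun t ht => ?_
  obtain ⟨v, hv⟩ := mem_TB_iff.1 (hl t ht)
  exact hv.mem_signedPerm

theorem movedSpace_list_prod_le {n : ℕ} {l : List (Equiv.Perm (BGround n))}
    (hl : ∀ t ∈ l, t ∈ TB n) {U : Submodule (ZMod 3) (Fin n → ZMod 3)}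
    (hU : ∀ t ∈ l, movedSpace t ≤ U) : movedSpace l.prod ≤ U := by
  induction l with
  | nil => simp [movedSpace_one]
  | cons t l ih =>
    rw [List.forall_mem_cons] at hl hU
    rw [List.prod_cons]
    exact (movedSpace_mul_le t (list_prod_mem_signedPerm hl.2)).trans
      (sup_le hU.1 (ih hl.2 hU.2))

theorem finrank_movedSpace_mul_le {n : ℕ} (v : Equiv.Perm (BGround n))
    {w : Equiv.Perm (BGround n)} (hw : w ∈ signedPerm n) :
    Module.finrank (ZMod 3) (movedSpace (v * w)) ≤
      Module.finrank (ZMod 3) (movedSpace v) + Module.finrank (ZMod 3) (movedSpace w) :=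
  (Submodule.finrank_mono (movedSpace_mul_le v hw)).trans
    (Submodule.finrank_add_le_finrank_add_finrank _ _)

theorem finrank_movedSpace_list_prod_le {n : ℕ} {l : List (Equiv.Perm (BGround n))}
    (hl : ∀ t ∈ l, t ∈ TB n) : Module.finrank (ZMod 3) (movedSpace l.prod) ≤ l.length := by
  induction l with
  | nil => rw [List.prod_nil, movedSpace_one, finrank_bot, List.length_nil]
  | cons t l ih =>
    rw [List.forall_mem_cons] at hl
    obtain ⟨v, hv⟩ := mem_TB_iff.1 hl.1
    have h := finrank_movedSpace_mul_le t (list_prod_mem_signedPerm hl.2)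
    rw [hv.finrank_movedSpace] at h
    rw [List.prod_cons, List.length_cons]
    have := ih hl.2
    omega

/-- Carter's lemma over `𝔽₃`: the reflection length is the dimension of the moved space. -/
theorem lenT_TB_eq_finrank {n : ℕ} {w : Equiv.Perm (BGround n)} (hw : w ∈ signedPerm n) :
    lenT (TB n) w = Module.finrank (ZMod 3) (movedSpace w) := by
  obtain ⟨l, hl, hlen, hprod⟩ := exists_reflection_factorization w hw
  have hmem : l.length ∈ {k | ∃ l : List (Equiv.Perm (BGround n)),
      (∀ t ∈ l, t ∈ TB n) ∧ l.length = k ∧ l.prod = w} := by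
    refine ⟨l, fun t ht => ?_, rfl, hprod⟩
    obtain ⟨v, hv, -⟩ := hl t ht
    exact mem_TB_iff.2 ⟨v, hv⟩
  apply le_antisymm
  · exact (Nat.sInf_le hmem).trans hlen
  · obtain ⟨l', hl', hlen', hprod'⟩ := Nat.sInf_mem ⟨_, hmem⟩
    rw [lenT, ← hlen', ← hprod']
    exact finrank_movedSpace_list_prod_le hl'

theorem lenT_TB_eq_zero {n : ℕ} {w : Equiv.Perm (BGround n)} (hw : w ∉ signedPerm n) :
    lenT (TB n) w = 0 := by
  rw [lenT, Nat.sInf_eq_zero]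
  right
  rw [Set.eq_empty_iff_forall_notMem]
  rintro k ⟨l, hl, -, rfl⟩
  exact hw (list_prod_mem_signedPerm hl)

theorem movedSpace_le_of_absLe {n : ℕ} {v w : Equiv.Perm (BGround n)} (hv : v ∈ signedPerm n)
    (hw : w ∈ signedPerm n) (h : absLe (TB n) v w) : movedSpace v ≤ movedSpace w := by
  have hvw := (signedPerm n).mul_mem ((signedPerm n).inv_mem hv) hw
  rw [absLe, lenT_TB_eq_finrank hv, lenT_TB_eq_finrank hw, lenT_TB_eq_finrank hvw] at h
  have hle := movedSpace_mul_le v hvw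
  rw [mul_inv_cancel_left] at hle
  rw [Submodule.eq_of_le_of_finrank_le hle
    ((Submodule.finrank_add_le_finrank_add_finrank _ _).trans h.ge)]
  exact le_sup_left

theorem IsRootOf.absLe_of_mem_movedSpace {n : ℕ} {t w : Equiv.Perm (BGround n)}
    {v : Fin n → ZMod 3} (h : IsRootOf t v) (hw : w ∈ signedPerm n) (hv : v ∈ movedSpace w) :
    absLe (TB n) t w := by
  have htw := (signedPerm n).mul_mem h.mem_signedPerm hw
  rw [absLe, h.inv_eq, lenT_TB_eq_finrank h.mem_signedPerm, lenT_TB_eq_finrank hw,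
    lenT_TB_eq_finrank htw, h.finrank_movedSpace]
  have hlt := h.finrank_movedSpace_mul_lt hw hv
  have hle := finrank_movedSpace_mul_le t htw
  rw [← mul_assoc, h.mul_self, one_mul, h.finrank_movedSpace] at hle
  omega

theorem FB_eq_movedSpace {n : ℕ} {w : Equiv.Perm (BGround n)} (hw : w ∈ signedPerm n) :
    FB n w = movedSpace w := by
  apply le_antisymm
  · refine sSup_le ?_
    rintro L ⟨t, hL, ht⟩
    obtain ⟨v, hv, rfl⟩ := lineOfB_iff.1 hL
    rw [← hv.movedSpace_eq]
    exact movedSpace_le_of_absLe hv.mem_signedPerm hw ht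
  · obtain ⟨l, hl, -, hprod⟩ := exists_reflection_factorization w hw
    have hle : movedSpace l.prod ≤ FB n w := by
      apply movedSpace_list_prod_le
      · intro t ht
        obtain ⟨v, hv, -⟩ := hl t ht
        exact mem_TB_iff.2 ⟨v, hv⟩
      · intro t ht
        obtain ⟨v, hv, hvw⟩ := hl t ht
        rw [hv.movedSpace_eq]
        exact le_sSup ⟨t, lineOfB_iff.2 ⟨v, hv, rfl⟩, hv.absLe_of_mem_movedSpace hw hvw⟩
    rwa [hprod] at hle

theorem mem_fixedSpace_iff_dotProduct {n : ℕ} {w : Equiv.Perm (BGround n)}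
    (hw : w ∈ signedPerm n) {y : Fin n → ZMod 3} :
    y ∈ fixedSpace w ↔ ∀ z ∈ movedSpace w, y ⬝ᵥ z = 0 := by
  refine ⟨fun hy z hz => dotProduct_eq_zero_of_mem_fixedSpace hw hy hz, fun h => ?_⟩
  rw [mem_fixedSpace]
  refine dotProduct_eq _ _ fun z => ?_
  have hz : signedAct w (signedAct w⁻¹ z) = z := by
    rw [← signedAct_mul w ((signedPerm n).inv_mem hw), mul_inv_cancel, signedAct_one]
  have h0 := h _ ⟨signedAct w⁻¹ z, rfl⟩
  rw [LinearMap.sub_apply, LinearMap.id_apply, hz, dotProduct_sub, sub_eq_zero] at h0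
  rw [h0, ← signedAct_dotProduct hw y, hz]

theorem signedAct_eq_of_mem_fixedSpace {n : ℕ} {v c : Equiv.Perm (BGround n)}
    (hv : v ∈ signedPerm n) (hc : c ∈ signedPerm n) {x : Fin n → ZMod 3}
    (hx : x ∈ fixedSpace (v⁻¹ * c)) : signedAct v x = signedAct c x := by
  have hvc := (signedPerm n).mul_mem ((signedPerm n).inv_mem hv) hc
  have hcx := signedAct_mul v hvc x
  rw [mul_inv_cancel_left, mem_fixedSpace.1 hx] at hcx
  exact hcx.symm

theorem finrank_fixedSpace_inv_mul {n : ℕ} {v c : Equiv.Perm (BGround n)}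
    (hv : v ∈ signedPerm n) (hc : c ∈ signedPerm n) (hfix : fixedSpace c = ⊥)
    (h : absLe (TB n) v c) :
    Module.finrank (ZMod 3) (fixedSpace (v⁻¹ * c)) = Module.finrank (ZMod 3) (movedSpace v) := by
  have hvc := (signedPerm n).mul_mem ((signedPerm n).inv_mem hv) hc
  rw [absLe, lenT_TB_eq_finrank hv, lenT_TB_eq_finrank hc, lenT_TB_eq_finrank hvc] at h
  have h1 := finrank_movedSpace_add c
  rw [hfix, finrank_bot] at h1
  have h2 := finrank_movedSpace_add (v⁻¹ * c)
  omega

theorem map_fixedSpace_eq_movedSpace {n : ℕ} {v c : Equiv.Perm (BGround n)}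
    (hv : v ∈ signedPerm n) (hc : c ∈ signedPerm n) (hfix : fixedSpace c = ⊥)
    (h : absLe (TB n) v c) :
    (fixedSpace (v⁻¹ * c)).map (signedAct c - LinearMap.id) = movedSpace v := by
  apply Submodule.eq_of_le_of_finrank_le
  · rintro _ ⟨x, hx, rfl⟩
    refine ⟨x, ?_⟩
    rw [LinearMap.sub_apply, LinearMap.sub_apply, signedAct_eq_of_mem_fixedSpace hv hc hx]
  · rw [← (Submodule.equivMapOfInjective _ (LinearMap.ker_eq_bot.1 hfix) _).finrank_eq,
      finrank_fixedSpace_inv_mul hv hc hfix h]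

theorem fixedSpace_inv_mul_sup_fixedSpace {n : ℕ} {v c : Equiv.Perm (BGround n)}
    (hv : v ∈ signedPerm n) (hc : c ∈ signedPerm n) (hfix : fixedSpace c = ⊥)
    (h : absLe (TB n) v c) : fixedSpace (v⁻¹ * c) ⊔ fixedSpace v = ⊤ := by
  apply Submodule.eq_top_of_disjoint
  · rw [finrank_fixedSpace_inv_mul hv hc hfix h, finrank_movedSpace_add, Module.finrank_fin_fun]
  · rw [Submodule.disjoint_def]
    intro x hx hx'
    rw [← Submodule.mem_bot (ZMod 3), ← hfix, mem_fixedSpace,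
      ← signedAct_eq_of_mem_fixedSpace hv hc hx, mem_fixedSpace.1 hx']

/-- An element below `c` is determined by its moved space if `c` has no nonzero fixed vector. -/
theorem eq_of_movedSpace_eq {n : ℕ} {v w c : Equiv.Perm (BGround n)}
    (hv : v ∈ signedPerm n) (hw : w ∈ signedPerm n) (hc : c ∈ signedPerm n)
    (hfix : fixedSpace c = ⊥) (hvc : absLe (TB n) v c) (hwc : absLe (TB n) w c)
    (h : movedSpace v = movedSpace w) : v = w := by
  have hX : fixedSpace (v⁻¹ * c) = fixedSpace (w⁻¹ * c) := by
    apply Submodule.map_injective_of_injective (LinearMap.ker_eq_bot.1 hfix)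
    rw [map_fixedSpace_eq_movedSpace hv hc hfix hvc, map_fixedSpace_eq_movedSpace hw hc hfix hwc, h]
  refine signedAct_injective hv hw fun x => ?_
  have hx : x ∈ fixedSpace (v⁻¹ * c) ⊔ fixedSpace v := by
    rw [fixedSpace_inv_mul_sup_fixedSpace hv hc hfix hvc]
    trivial
  obtain ⟨y, hy, z, hz, rfl⟩ := Submodule.mem_sup.1 hx
  have hz' : z ∈ fixedSpace w := by
    rwa [mem_fixedSpace_iff_dotProduct hw, ← h, ← mem_fixedSpace_iff_dotProduct hv]
  rw [map_add, map_add, signedAct_eq_of_mem_fixedSpace hv hc hy,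
    signedAct_eq_of_mem_fixedSpace hw hc (hX ▸ hy), mem_fixedSpace.1 hz, mem_fixedSpace.1 hz']

theorem cB_mem_signedPerm (n : ℕ) : cB n ∈ signedPerm n := by
  rintro ⟨i, b⟩
  by_cases h : i.val + 1 < n <;> simp [cB, h]

theorem fixedSpace_cB (n : ℕ) : fixedSpace (cB n) = ⊥ := by
  rw [eq_bot_iff]
  intro y hy
  have hfix : ∀ p, oddExt y (cB n p) = oddExt y p := by
    intro p
    conv_lhs => rw [← mem_fixedSpace.1 hy]
    rw [oddExt_signedAct (cB_mem_signedPerm n)]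
    exact congrArg _ ((cB n).symm_apply_apply p)
  rw [Submodule.mem_bot]
  funext i
  have hn : 0 < n := i.pos
  have hconst : ∀ k (hk : k < n), y ⟨k, hk⟩ = y ⟨0, hn⟩ := by
    intro k
    induction k with
    | zero => exact fun _ => rfl
    | succ k ih =>
      intro hk
      have h := hfix (⟨k, by omega⟩, false)
      simp only [cB, Equiv.coe_fn_mk, dif_pos hk, oddExt, Bool.false_eq_true, if_false] at h
      rw [h, ih]
  have hlast := hfix (⟨n - 1, by omega⟩, false)
  have hnot : ¬ n - 1 + 1 < n := by omega
  simp only [cB, Equiv.coe_fn_mk, dif_neg hnot, oddExt, Bool.not_false, Bool.false_eq_true,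
    if_false, if_true] at hlast
  rw [hconst (n - 1)] at hlast
  have h3 : (3 : ZMod 3) = 0 := rfl
  rw [hconst i.val i.isLt, Pi.zero_apply]
  linear_combination hlast + y ⟨0, hn⟩ * h3

theorem mem_signedPerm_of_mem_NC {n : ℕ} {w : Equiv.Perm (BGround n)}
    (h : w ∈ NC (TB n) (cB n)) : w ∈ signedPerm n := by
  have hc := cB_mem_signedPerm n
  by_contra hw
  have hwc : w⁻¹ * cB n ∉ signedPerm n := by
    rwa [Subgroup.mul_mem_cancel_right _ hc, Subgroup.inv_mem_iff]
  have hlen : lenT (TB n) (cB n) = lenT (TB n) w + lenT (TB n) (w⁻¹ * cB n) := h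
  rw [lenT_TB_eq_zero hw, lenT_TB_eq_zero hwc, lenT_TB_eq_finrank hc] at hlen
  have hn := finrank_movedSpace_add (cB n)
  rw [hlen, fixedSpace_cB, finrank_bot] at hn
  obtain rfl : n = 0 := hn.symm
  exact hw fun p => p.1.elim0

/-- `f'` is injective on the reflections of `W(B_n)`, and `F` is an
order-preserving, rank-preserving, injective map from `NC(B_n)` to the lattice of
linear subspaces of `𝔽₃^n`. -/
theorem typeB_building_embedding (n : ℕ) :
    (∀ t t' L L', lineOfB n t L → lineOfB n t' L' → L = L' → t = t') ∧
    (∀ v ∈ NC (TB n) (cB n), ∀ w ∈ NC (TB n) (cB n),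
       absLe (TB n) v w → FB n v ≤ FB n w) ∧
    (∀ w ∈ NC (TB n) (cB n),
       Module.finrank (ZMod 3) (FB n w) = lenT (TB n) w) ∧
    (∀ v ∈ NC (TB n) (cB n), ∀ w ∈ NC (TB n) (cB n), FB n v = FB n w → v = w) := by
  refine ⟨fun t t' L L' hL hL' h => ?_, fun v hv w hw h => ?_, fun w hw => ?_,
    fun v hv w hw h => ?_⟩
  · obtain ⟨v, hv, rfl⟩ := lineOfB_iff.1 hL
    obtain ⟨v', hv', rfl⟩ := lineOfB_iff.1 hL'
    exact hv.eq_of_span_eq hv' h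
  · have hv' := mem_signedPerm_of_mem_NC hv
    have hw' := mem_signedPerm_of_mem_NC hw
    rw [FB_eq_movedSpace hv', FB_eq_movedSpace hw']
    exact movedSpace_le_of_absLe hv' hw' h
  · have hw' := mem_signedPerm_of_mem_NC hw
    rw [FB_eq_movedSpace hw', lenT_TB_eq_finrank hw']
  · have hv' := mem_signedPerm_of_mem_NC hv
    have hw' := mem_signedPerm_of_mem_NC hw
    rw [FB_eq_movedSpace hv', FB_eq_movedSpace hw'] at h
    exact eq_of_movedSpace_eq hv' hw' (cB_mem_signedPerm n) (fixedSpace_cB n) hv hw h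

end NCPaper
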